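/- For the group G = C_3^3 (the direct sum of three copies of the cyclic group of order 3), both 14 = η(C_3^3) - 3 and 15 = η(C_3^3) - 2 belong to C_0(G); that is, every zero-sum sequence over C_3^3 of length exactly 14, and every zero-sum sequence over C_3^3 of length exactly 15, contains a short zero-sum subsequence. -/

import Mathlib

/-- `S` contains a short zero-sum subsequence: a nonempty subsequence with sum `0`
whose length is at most `exp(G)`. -/
def HasShortZeroSumSubseq {G : Type*} [AddCommGroup G] (S : Multiset G) : Prop :=
  ∃ T, T ≤ S ∧ T.sum = 0 ∧ 1 ≤ Multiset.card T ∧ Multiset.card T ≤ AddMonoid.exponent G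

/-- `η G` : the smallest `d` such that every sequence over `G` of length at least `d`
contains a short zero-sum subsequence. -/
noncomputable def etaConst (G : Type*) [AddCommGroup G] : ℕ :=
  sInf {d : ℕ | ∀ S : Multiset G, d ≤ Multiset.card S → HasShortZeroSumSubseq S}

/-- `D G` : the Davenport constant, the smallest `d` such that every sequence over `G`
of length at least `d` contains a nonempty zero-sum subsequence. -/
noncomputable def davenport (G : Type*) [AddCommGroup G] : ℕ :=
  sInf {d : ℕ | ∀ S : Multiset G, d ≤ Multiset.card S → ∃ T, T ≤ S ∧ T ≠ 0 ∧ T.sum = 0}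

/-- `C₀(G)` : the set of `t ∈ [D(G)+1, η(G)-1]` such that every zero-sum sequence over
`G` of length exactly `t` contains a short zero-sum subsequence. -/
def C0 (G : Type*) [AddCommGroup G] : Set ℕ :=
  {t | davenport G + 1 ≤ t ∧ t ≤ etaConst G - 1 ∧
    ∀ S : Multiset G, Multiset.card S = t → S.sum = 0 → HasShortZeroSumSubseq S}

open Finset

/-! ### The exponent and the Davenport constant -/

theorem exponent_zmod_three_cube : AddMonoid.exponent (Fin 3 → ZMod 3) = 3 := by
  have h : AddMonoid.exponent (Fin 3 → ZMod 3) ∣ 3 :=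
    AddMonoid.exponent_dvd_of_forall_nsmul_eq_zero (by decide)
  refine ((Nat.dvd_prime Nat.prime_three).1 h).resolve_left fun h1 => ?_
  have := AddMonoid.exp_eq_one_iff.1 h1
  exact not_subsingleton (Fin 3 → ZMod 3) this

/-- The Chevalley–Warning bound for zero-sum subsequences over `C_p^n`. -/
theorem exists_zero_sum_of_card_lt (p n : ℕ) [Fact p.Prime] (S : Multiset (Fin n → ZMod p))
    (hS : n * (p - 1) < Multiset.card S) : ∃ T, T ≤ S ∧ T ≠ 0 ∧ T.sum = 0 := by
  classical
  let f : Fin n → MvPolynomial S.ToType (ZMod p) := fun i =>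
    ∑ s : S.ToType, MvPolynomial.C (s.1 i) * MvPolynomial.X s ^ (p - 1)
  have hdeg (i : Fin n) : (f i).totalDegree ≤ p - 1 := by
    refine MvPolynomial.totalDegree_finsetSum_le fun s _ => ?_
    refine (MvPolynomial.totalDegree_mul _ _).trans ?_
    simp [MvPolynomial.totalDegree_X_pow]
  have hdvd : p ∣ Nat.card {x : S.ToType → ZMod p // ∀ i, MvPolynomial.eval x (f i) = 0} := by
    rw [@Nat.card_eq_fintype_card _ (_)]
    refine char_dvd_card_solutions_of_fintype_sum_lt p (f := f) ?_
    calc ∑ i, (f i).totalDegree ≤ ∑ _i : Fin n, (p - 1) := sum_le_sum fun i _ => hdeg i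
        _ = n * (p - 1) := by simp
        _ < Fintype.card S.ToType := by simpa using hS
  have hp : p.Prime := Fact.out
  let z : {x : S.ToType → ZMod p // ∀ i, MvPolynomial.eval x (f i) = 0} :=
    ⟨0, fun i => by simp [f, hp.one_lt, tsub_eq_zero_iff_le]⟩
  have : Nontrivial {x : S.ToType → ZMod p // ∀ i, MvPolynomial.eval x (f i) = 0} :=
    Finite.one_lt_card_iff_nontrivial.1 <|
      hp.one_lt.trans_le (Nat.le_of_dvd (Nat.card_pos_iff.2 ⟨⟨z⟩, inferInstance⟩) hdvd)
  obtain ⟨x, hx⟩ := exists_ne z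
  refine ⟨(univ.filter fun s => x.1 s ≠ 0).val.map fun s : S.ToType => s.1, ?_, ?_, ?_⟩
  · conv_rhs => rw [← Multiset.map_univ_coe S]
    exact Multiset.map_le_map (val_le_iff.2 (filter_subset _ _))
  · rw [← Subtype.coe_ne_coe, Function.ne_iff] at hx
    obtain ⟨s, hs⟩ := hx
    exact fun h => Multiset.eq_zero_iff_forall_notMem.1 h s.1
      (Multiset.mem_map_of_mem _ (mem_filter.2 ⟨mem_univ s, hs⟩))
  · funext i
    have := x.2 i
    simp only [f, map_sum, map_mul, map_pow, MvPolynomial.eval_C, MvPolynomial.eval_X,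
      ZMod.pow_card_sub_one, mul_ite, mul_one, mul_zero] at this
    change (∑ s ∈ univ.filter fun s => x.1 s ≠ 0, s.1) i = 0
    rw [Finset.sum_apply, sum_filter]
    simpa only [ne_eq] using this

theorem davenport_zmod_three_cube_le : davenport (Fin 3 → ZMod 3) ≤ 7 :=
  Nat.sInf_le fun S hS => exists_zero_sum_of_card_lt 3 3 S (by omega)

/-! ### A lower bound for the constant `η` -/

/-- The nonzero points of the paraboloid `z = x² + y²`. -/
def puncturedParaboloid : Finset (Fin 3 → ZMod 3) :=
  univ.filter fun v => v ≠ 0 ∧ v 2 = v 0 ^ 2 + v 1 ^ 2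

theorem card_puncturedParaboloid : puncturedParaboloid.card = 8 := by decide +kernel

theorem zero_sum_of_mem_puncturedParaboloid : ∀ a ∈ puncturedParaboloid,
    a ≠ 0 ∧ ∀ b ∈ puncturedParaboloid, a + b ≠ 0 ∧
      ∀ c ∈ puncturedParaboloid, a + b + c = 0 → a = b ∧ a = c := by
  decide +kernel

theorem not_hasShortZeroSumSubseq_puncturedParaboloid :
    ¬ HasShortZeroSumSubseq (2 • puncturedParaboloid.val) := by
  rintro ⟨T, hT, hsum, hpos, hle⟩
  rw [exponent_zmod_three_cube] at hle
  have hmem : ∀ a ∈ T, a ∈ puncturedParaboloid := fun a ha =>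
    Multiset.mem_of_mem_nsmul (Multiset.mem_of_le hT ha)
  obtain h | h | h : Multiset.card T = 1 ∨ Multiset.card T = 2 ∨ Multiset.card T = 3 := by omega
  · obtain ⟨a, rfl⟩ := Multiset.card_eq_one.1 h
    simp only [Multiset.sum_singleton] at hsum
    exact (zero_sum_of_mem_puncturedParaboloid a (hmem a (by simp))).1 hsum
  · obtain ⟨a, b, rfl⟩ := Multiset.card_eq_two.1 h
    simp only [Multiset.insert_eq_cons, Multiset.sum_cons, Multiset.sum_singleton] at hsum
    exact ((zero_sum_of_mem_puncturedParaboloid a (hmem a (by simp))).2 b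
      (hmem b (by simp))).1 hsum
  · obtain ⟨a, b, c, rfl⟩ := Multiset.card_eq_three.1 h
    simp only [Multiset.insert_eq_cons, Multiset.sum_cons, Multiset.sum_singleton,
      ← add_assoc] at hsum
    obtain ⟨rfl, rfl⟩ := ((zero_sum_of_mem_puncturedParaboloid a (hmem a (by simp))).2 b
      (hmem b (by simp))).2 c (hmem c (by simp)) hsum
    have h3 := Multiset.count_le_of_le a hT
    have h1 := Multiset.nodup_iff_count_le_one.1 puncturedParaboloid.nodup a
    simp only [Multiset.insert_eq_cons, Multiset.count_cons_self, Multiset.count_singleton_self,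
      Multiset.count_nsmul] at h3
    omega

theorem hasShortZeroSumSubseq_of_three_le_count {S : Multiset (Fin 3 → ZMod 3)}
    {g : Fin 3 → ZMod 3} (h : 3 ≤ S.count g) : HasShortZeroSumSubseq S := by
  refine ⟨Multiset.replicate 3 g, Multiset.le_count_iff_replicate_le.1 h, ?_, by simp, ?_⟩
  · have h3 := AddMonoid.exponent_nsmul_eq_zero g
    rw [exponent_zmod_three_cube] at h3
    rw [Multiset.sum_replicate, h3]
  · simp [exponent_zmod_three_cube]

theorem sixteen_lt_etaConst_zmod_three_cube : 16 < etaConst (Fin 3 → ZMod 3) := by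
  refine Nat.lt_of_succ_le (le_csInf ⟨55, fun S hS => ?_⟩ fun d hd => ?_)
  · by_contra hS'
    have hcount : ∀ g, S.count g ≤ 2 := fun g => by
      by_contra! hg
      exact hS' (hasShortZeroSumSubseq_of_three_le_count hg)
    have := calc Multiset.card S = ∑ g, S.count g := (Multiset.sum_count_eq_card (by simp)).symm
      _ ≤ ∑ _g : Fin 3 → ZMod 3, 2 := sum_le_sum fun g _ => hcount g
      _ = 54 := by simp [ZMod.card]
    omega
  · by_contra! hd'
    refine not_hasShortZeroSumSubseq_puncturedParaboloid (hd _ ?_)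
    rw [Multiset.card_nsmul, card_val, card_puncturedParaboloid]
    omega

/-! ### Cap sets -/

/-- Checks `P` on every list obtained from `L` by prepending, one after the other, terms of the
second list, none of which may complete a zero-sum triple with entries of the current list. -/
def forallCapExtensions {G : Type*} [AddCommGroup G] [DecidableEq G] (P : List G → Bool) :
    List G → List G → Bool
  | L, [] => P L
  | L, c :: cs => forallCapExtensions P L cs &&
      (L.any (fun x => L.any fun y => decide (x + y + c = 0)) ||
        forallCapExtensions P (c :: L) cs)

theorem exists_list_of_forallCapExtensions {G : Type*} [AddCommGroup G] [DecidableEq G]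
    {P : List G → Bool} {A : Finset G}
    (hA : ∀ a ∈ A, ∀ b ∈ A, ∀ c ∈ A, a + b + c = 0 → a = c) {cs : List G} :
    ∀ {L : List G}, L.Nodup → (∀ x ∈ L, x ∈ A) → (∀ x ∈ A, x ∈ L ∨ x ∈ cs) →
      forallCapExtensions P L cs = true → ∃ l : List G, l.Nodup ∧ l.toFinset = A ∧ P l = true := by
  induction cs with
  | nil =>
    intro L hL hLA hAL h
    refine ⟨L, hL, ?_, h⟩
    ext x
    simpa using ⟨hLA x, fun hx => by simpa using hAL x hx⟩
  | cons c cs ih =>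
    intro L hL hLA hAL h
    simp only [forallCapExtensions, Bool.and_eq_true, Bool.or_eq_true, List.any_eq_true,
      decide_eq_true_eq] at h
    by_cases hc : c ∈ A ∧ c ∉ L
    · refine ih (List.nodup_cons.2 ⟨hc.2, hL⟩) ?_ ?_ (h.2.resolve_left ?_)
      · simpa using ⟨hc.1, hLA⟩
      · intro x hx
        have := hAL x hx
        simp only [List.mem_cons] at this ⊢
        tauto
      · rintro ⟨x, hx, y, hy, hxy⟩
        obtain rfl := hA x (hLA x hx) y (hLA y hy) c hc.1 hxy
        exact hc.2 hx
    · refine ih hL hLA (fun x hx => ?_) h.1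
      have := hAL x hx
      simp only [List.mem_cons] at this
      by_cases hxc : x = c
      · subst hxc
        tauto
      · tauto

theorem add_add_self_eq_zero (v : Fin 3 → ZMod 3) : v + v + v = 0 := by
  revert v
  decide

theorem ThreeAPFree.eq_of_add_add_eq_zero {s : Set (Fin 3 → ZMod 3)} (hs : ThreeAPFree s)
    {a b c : Fin 3 → ZMod 3} (ha : a ∈ s) (hb : b ∈ s) (hc : c ∈ s) (h : a + b + c = 0) :
    a = c := by
  have h' : ∀ x y z : Fin 3 → ZMod 3, x + y + z = 0 → x + z = y + y := fun x y z hxyz => by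
    have := add_add_self_eq_zero y
    linear_combination hxyz - this
  have hab : a = b := hs ha hb hc (h' a b c h)
  subst hab
  exact hs ha hc ha (h' a c a (by rw [← h]; abel))

/-- All elements of `C_3^3`. -/
def zmodThreeCubeList : List (Fin 3 → ZMod 3) :=
  ([0, 1, 2] : List (ZMod 3)).flatMap fun x => ([0, 1, 2] : List (ZMod 3)).flatMap fun y =>
    ([0, 1, 2] : List (ZMod 3)).map fun z => ![x, y, z]

theorem mem_zmodThreeCubeList : ∀ v, v ∈ zmodThreeCubeList := by decide

theorem forallCapExtensions_standard_basis :
    forallCapExtensions (fun l => decide (l.length ≤ 9 ∧ (l.length = 8 → l.sum ≠ 0) ∧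
      (l.length = 9 → l.sum = 0)))
      [0, Pi.single 0 1, Pi.single 1 1, Pi.single 2 1] zmodThreeCubeList = true := by
  decide +kernel

theorem ThreeAPFree.card_and_sum_of_basis_mem {A : Finset (Fin 3 → ZMod 3)}
    (hA : ThreeAPFree (A : Set (Fin 3 → ZMod 3))) (h0 : 0 ∈ A) (hb : ∀ i, Pi.single i 1 ∈ A) :
    A.card ≤ 9 ∧ (A.card = 8 → ∑ a ∈ A, a ≠ 0) ∧ (A.card = 9 → ∑ a ∈ A, a = 0) := by
  obtain ⟨l, hl, rfl, hP⟩ := exists_list_of_forallCapExtensions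
    (fun a ha b hb c hc => hA.eq_of_add_add_eq_zero ha hb hc) (by decide)
    (by simpa using ⟨h0, hb 0, hb 1, hb 2⟩) (fun x _ => Or.inr (mem_zmodThreeCubeList x))
    forallCapExtensions_standard_basis
  rw [List.toFinset_card_of_nodup hl, List.sum_toFinset _ hl, List.map_id']
  exact of_decide_eq_true hP

theorem ThreeAPFree.span_eq_top {A : Finset (Fin 3 → ZMod 3)}
    (hA : ThreeAPFree (A : Set (Fin 3 → ZMod 3))) (h0 : 0 ∈ A) (hcard : 8 ≤ A.card) :
    Submodule.span (ZMod 3) (A : Set (Fin 3 → ZMod 3)) = ⊤ := by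
  set W := Submodule.span (ZMod 3) (A : Set (Fin 3 → ZMod 3))
  have hinter : A ∩ A.image (-·) ⊆ {0} := by
    intro x hx
    obtain ⟨hx, y, hy, rfl⟩ : x ∈ A ∧ ∃ y ∈ A, -y = x := by simpa using hx
    simpa using hA hx h0 hy (by simp)
  have hunion : 15 ≤ (A ∪ A.image (-·)).card := by
    have h1 := card_union_add_card_inter A (A.image (-·))
    have h2 := card_le_card hinter
    rw [card_image_of_injective _ neg_injective] at h1
    rw [card_singleton] at h2
    omega
  have hsub : ((A ∪ A.image (-·) : Finset _) : Set (Fin 3 → ZMod 3)) ⊆ W := by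
    intro x hx
    obtain hx | ⟨y, hy, rfl⟩ : x ∈ A ∨ ∃ y ∈ A, -y = x := by
      simpa only [mem_coe, mem_union, mem_image] using hx
    · exact Submodule.subset_span hx
    · exact W.neg_mem (Submodule.subset_span hy)
  have hW : 15 ≤ 3 ^ Module.finrank (ZMod 3) W := by
    have h1 := Set.ncard_le_ncard hsub (Set.toFinite _)
    have h2 := Module.natCard_eq_pow_finrank (K := ZMod 3) (V := W)
    rw [Set.ncard_coe_finset] at h1
    rw [Nat.card_zmod] at h2
    rw [← h2]
    exact hunion.trans h1
  refine Submodule.eq_top_of_finrank_eq (le_antisymm (Submodule.finrank_le W) ?_)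
  rw [Module.finrank_fin_fun]
  by_contra! hlt
  have := Nat.pow_le_pow_right (n := 3) (by norm_num) (Nat.le_of_lt_succ hlt)
  omega

theorem ThreeAPFree.card_and_sum {A : Finset (Fin 3 → ZMod 3)}
    (hA : ThreeAPFree (A : Set (Fin 3 → ZMod 3))) (h0 : 0 ∈ A) (hcard : 8 ≤ A.card) :
    A.card ≤ 9 ∧ (A.card = 8 → ∑ a ∈ A, a ≠ 0) ∧ (A.card = 9 → ∑ a ∈ A, a = 0) := by
  let b := Module.Basis.ofSpan (hA.span_eq_top h0 hcard).ge
  have hbA : Set.range b ⊆ A := Module.Basis.ofSpan_subset _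
  have := Module.Finite.finite_basis b
  have := Fintype.ofFinite ↑((linearIndepOn_empty (ZMod 3) (id : (Fin 3 → ZMod 3) → _)).extend
    (Set.empty_subset (A : Set (Fin 3 → ZMod 3))))
  let b' := b.reindex (Fintype.equivFinOfCardEq (n := 3)
    (by rw [← Module.finrank_eq_card_basis b, Module.finrank_fin_fun]))
  let e := b'.equivFun
  have hmap : ThreeAPFree ((A.map e.toEquiv.toEmbedding : Finset _) : Set (Fin 3 → ZMod 3)) := by
    rw [coe_map]
    rintro _ ⟨x, hx, rfl⟩ _ ⟨y, hy, rfl⟩ _ ⟨z, hz, rfl⟩ h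
    change e x + e z = e y + e y at h
    rw [← map_add, ← map_add] at h
    exact congrArg e (hA hx hy hz (e.injective h))
  have key := hmap.card_and_sum_of_basis_mem (mem_map.2 ⟨0, h0, map_zero e⟩) fun i =>
    mem_map.2 ⟨b' i, hbA (by simp [b']), by
      ext j; simp [e, Pi.single_apply, eq_comm]⟩
  have hsum : ∑ a ∈ A.map e.toEquiv.toEmbedding, a = e (∑ a ∈ A, a) := by
    rw [sum_map, map_sum]
    rfl
  rw [hsum, card_map] at key
  simpa [-map_sum] using key

/-! ### Zero-sum sequences without short zero-sum subsequences -/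

theorem threeAPFree_insert_zero_toFinset {S : Multiset (Fin 3 → ZMod 3)}
    (hS : ¬ HasShortZeroSumSubseq S) :
    ThreeAPFree ((insert 0 S.toFinset : Finset _) : Set (Fin 3 → ZMod 3)) := by
  intro a ha b hb c hc h
  by_contra hab
  have hsum : a + b + c = 0 := by
    have := add_add_self_eq_zero b
    linear_combination h + this
  have hbc : b ≠ c := by
    rintro rfl
    exact hab (add_right_cancel h)
  have hac : a ≠ c := by
    rintro rfl
    have h1 := add_add_self_eq_zero a
    have h2 : a + b + a = a + a + a := by rw [hsum, h1]
    exact hab (by simpa using h2.symm)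
  have hcard : ({a, b, c} : Finset (Fin 3 → ZMod 3)).card = 3 := card_eq_three.2
    ⟨a, b, c, hab, hac, hbc, rfl⟩
  refine hS ⟨(({a, b, c} : Finset _).erase 0).val, ?_, ?_, ?_, ?_⟩
  · refine (Multiset.le_iff_subset (nodup _)).2 fun x hx => ?_
    have hx : x ≠ 0 ∧ (x = a ∨ x = b ∨ x = c) := by
      simpa only [mem_val, mem_erase, mem_insert, mem_singleton] using hx
    simp only [coe_insert, Set.mem_insert_iff, mem_coe, Multiset.mem_toFinset] at ha hb hc
    rcases hx with ⟨hx, rfl | rfl | rfl⟩ <;> tauto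
  · have h1 : ∑ x ∈ ({a, b, c} : Finset _).erase 0, x = ∑ x ∈ ({a, b, c} : Finset _), x :=
      sum_erase _ rfl
    have h2 : ∑ x ∈ ({a, b, c} : Finset _), x = a + b + c := by
      rw [sum_insert (by simp [hab, hac]), sum_pair hbc, add_assoc]
    rw [sum_val]
    exact h1.trans (h2.trans hsum)
  · have := pred_card_le_card_erase (s := ({a, b, c} : Finset (Fin 3 → ZMod 3))) (a := 0)
    rw [card_val]
    omega
  · rw [exponent_zmod_three_cube, card_val]
    exact card_erase_le.trans hcard.le

theorem hasShortZeroSumSubseq_of_sum_eq_zero {S : Multiset (Fin 3 → ZMod 3)}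
    (hcard : Multiset.card S = 14 ∨ Multiset.card S = 15) (hsum : S.sum = 0) :
    HasShortZeroSumSubseq S := by
  by_contra hS
  have hcount (g) : S.count g ≤ 2 := by
    by_contra! hg
    exact hS (hasShortZeroSumSubseq_of_three_le_count hg)
  have h0 : 0 ∉ S.toFinset := fun h => hS
    ⟨{0}, by simpa using h, by simp, by simp, by simp [exponent_zmod_three_cube]⟩
  have hcountA (g) : S.toFinset.val.count g = if g ∈ S then 1 else 0 := by
    rw [Multiset.toFinset_val, Multiset.count_dedup]
  have hle : S ≤ 2 • S.toFinset.val := Multiset.le_iff_count.2 fun g => by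
    rw [Multiset.count_nsmul, hcountA]
    split_ifs with hg
    · exact hcount g
    · simp [hg]
  obtain ⟨D, hD⟩ := Multiset.le_iff_exists_add.1 hle
  have hDS : D ≤ S := Multiset.le_iff_count.2 fun g => by
    have := congrArg (Multiset.count g) hD
    rw [Multiset.count_nsmul, hcountA, Multiset.count_add] at this
    split_ifs at this with hg
    · have := Multiset.one_le_count_iff_mem.2 hg
      omega
    · omega
  have hDcard : 2 * S.toFinset.card = Multiset.card S + Multiset.card D := by
    simpa only [Multiset.card_nsmul, Multiset.card_add, card_val, smul_eq_mul] using
      congrArg Multiset.card hD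
  have hDsum : 2 • ∑ a ∈ S.toFinset, a = D.sum := by
    simpa only [Multiset.sum_nsmul, Multiset.sum_add, hsum, zero_add, sum_val, id] using
      congrArg Multiset.sum hD
  obtain ⟨hA9, hA7, hA8⟩ := (threeAPFree_insert_zero_toFinset hS).card_and_sum
    (mem_insert_self _ _) (by rw [card_insert_of_notMem h0]; omega)
  rw [card_insert_of_notMem h0] at hA9 hA7 hA8
  rw [sum_insert h0, zero_add] at hA7 hA8
  obtain h7 | h8 : S.toFinset.card = 7 ∨ S.toFinset.card = 8 := by omega
  · have hD0 : D = 0 := Multiset.card_eq_zero.1 (by omega)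
    rw [hD0, Multiset.sum_zero, two_nsmul] at hDsum
    have := add_add_self_eq_zero (∑ a ∈ S.toFinset, a)
    rw [hDsum, zero_add] at this
    exact hA7 (by omega) this
  · rw [hA8 (by omega), smul_zero] at hDsum
    exact hS ⟨D, hDS, hDsum.symm, by omega, by rw [exponent_zmod_three_cube]; omega⟩

theorem stmt_19 : 14 ∈ C0 (Fin 3 → ZMod 3) ∧ 15 ∈ C0 (Fin 3 → ZMod 3) := by
  have hD := davenport_zmod_three_cube_le
  have hη := sixteen_lt_etaConst_zmod_three_cube
  exact ⟨⟨by omega, by omega, fun S hS => hasShortZeroSumSubseq_of_sum_eq_zero (.inl hS)⟩,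
    ⟨by omega, by omega, fun S hS => hasShortZeroSumSubseq_of_sum_eq_zero (.inr hS)⟩⟩
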